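/- For every fixed rotor sequence, the supremum over all even initial configurations C and all times T of the single-vertex discrepancy |f(0,T) − E(0,T)| between Propp machine and linear machine equals ∑_{x ∈ V} maxcon(x); in particular this sum is a tight upper bound for the single-vertex discrepancies. -/

import Mathlib

open Finset

/-- Vertices: we work on `ℤ × ℤ`; the grid `V` consists of points with
`x₁ ≡ x₂ (mod 2)`. -/
abbrev Vtx : Type := ℤ × ℤ

/-- The four diagonal directions. -/
def DIRset : Finset Vtx := {(1,1), (1,-1), (-1,-1), (-1,1)}

/-- Membership in `V`: both coordinates have the same parity. -/
def inV (x : Vtx) : Prop := x.1 % 2 = x.2 % 2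

/-- `H x t`: probability that a random-walk chip starting at `x` is at the
origin after `t` steps. -/
noncomputable def H (x : Vtx) (t : ℕ) : ℝ :=
  if x.1 % 2 = (t : ℤ) % 2 ∧ x.2 % 2 = (t : ℤ) % 2 ∧ |x.1| ≤ (t : ℤ) ∧ |x.2| ≤ (t : ℤ) then
    (4 : ℝ) ^ (-(t : ℤ)) * (Nat.choose t (((t : ℤ) + x.1) / 2).toNat)
      * (Nat.choose t (((t : ℤ) + x.2) / 2).toNat)
  else 0

/-- `INF x A t := H (x+A) (t-1) - H x t`, for `t ≥ 1`. -/
noncomputable def INF (x A : Vtx) (t : ℕ) : ℝ := H (x + A) (t - 1) - H x t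

/-- A rotor sequence: a cyclic permutation of the four directions. -/
def IsRotorSequence (next : Vtx → Vtx) : Prop :=
  ∀ A ∈ DIRset, ({A, next A, next^[2] A, next^[3] A} : Finset Vtx) = DIRset

/-- One step of the Propp machine: a vertex holding `k` chips and rotor `d`
sends chip `i` (for `i = 0, …, k-1`) to `x + next^[i] d` and sets its rotor
to `next^[k] d`. -/
def proppStep (next : Vtx → Vtx) (st : (Vtx → ℕ) × (Vtx → Vtx)) :
    (Vtx → ℕ) × (Vtx → Vtx) :=
  (fun y => ∑ A ∈ DIRset,
      ((Finset.range (st.1 (y - A))).filter (fun i => next^[i] (st.2 (y - A)) = A)).card,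
   fun x => next^[st.1 x] (st.2 x))

/-- The Propp machine after `t` steps: chip counts and rotor directions. -/
def propp (next : Vtx → Vtx) (f0 : Vtx → ℕ) (arr0 : Vtx → Vtx) :
    ℕ → (Vtx → ℕ) × (Vtx → Vtx)
  | 0 => (f0, arr0)
  | t + 1 => proppStep next (propp next f0 arr0 t)

/-- An initial configuration is even if chips lie only on vertices `x ~ 0`. -/
def EvenConfig (f0 : Vtx → ℕ) : Prop :=
  ∀ x : Vtx, ¬(x.1 % 2 = 0 ∧ x.2 % 2 = 0) → f0 x = 0

/-- The linear machine: each vertex sends a quarter of its chips to each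
neighbor. -/
noncomputable def lin (f0 : Vtx → ℕ) : ℕ → Vtx → ℝ
  | 0 => fun x => (f0 x : ℝ)
  | t + 1 => fun x => (1/4) * ∑ A ∈ DIRset, lin f0 t (x + A)

/-- `sTime … x i`: the first time `u` with `i < ∑_{t=0}^{u} f(x,t)`, i.e. the
time at which `x` is occupied by its `i`-th chip. -/
noncomputable def sTime (next : Vtx → Vtx) (f0 : Vtx → ℕ) (arr0 : Vtx → Vtx)
    (x : Vtx) (i : ℕ) : ℕ :=
  sInf {u : ℕ | i < ∑ t ∈ Finset.range (u + 1), (propp next f0 arr0 t).1 x}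

/-- The contribution of vertex `x` for run-time `T`.  The chips with
`s_i(x) < T` are exactly those with `i < ∑_{t=0}^{T-1} f(x,t)`. -/
noncomputable def con (next : Vtx → Vtx) (f0 : Vtx → ℕ) (arr0 : Vtx → Vtx)
    (x : Vtx) (T : ℕ) : ℝ :=
  ∑ i ∈ Finset.range (∑ t ∈ Finset.range T, (propp next f0 arr0 t).1 x),
    INF x (next^[i] (arr0 x)) (T - sTime next f0 arr0 x i)

/-- `maxcon next x`: supremum of `con` over all even initial configurations
(with rotors pointing in directions of `DIRset`) and all run-times. -/
noncomputable def maxcon (next : Vtx → Vtx) (x : Vtx) : ℝ :=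
  sSup {c : ℝ | ∃ f0 arr0 T, EvenConfig f0 ∧ (∀ y : Vtx, arr0 y ∈ DIRset) ∧
    c = con next f0 arr0 x T}

/-- `mincon next x`: infimum of `con` over all even initial configurations
(with rotors pointing in directions of `DIRset`) and all run-times. -/
noncomputable def mincon (next : Vtx → Vtx) (x : Vtx) : ℝ :=
  sInf {c : ℝ | ∃ f0 arr0 T, EvenConfig f0 ∧ (∀ y : Vtx, arr0 y ∈ DIRset) ∧
    c = con next f0 arr0 x T}

section RotorFacts

variable {next : Vtx → Vtx}

lemma DIR_card : DIRset.card = 4 := by decide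

lemma mem_DIR {A : Vtx} : A ∈ DIRset ↔
    A = (1,1) ∨ A = (1,-1) ∨ A = (-1,-1) ∨ A = (-1,1) := by
  simp [DIRset]

lemma next_mem (hn : IsRotorSequence next) {A : Vtx} (hA : A ∈ DIRset) : next A ∈ DIRset := by
  rw [← hn A hA]; simp

lemma iter_mem (hn : IsRotorSequence next) {A : Vtx} (hA : A ∈ DIRset) (i : ℕ) :
    next^[i] A ∈ DIRset := by
  induction i with
  | zero => exact hA
  | succ i ih => rw [Function.iterate_succ_apply']; exact next_mem hn ih

lemma four_distinct {α : Type*} [DecidableEq α] {a b c d : α}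
    (h : ({a, b, c, d} : Finset α).card = 4) :
    a ≠ b ∧ a ≠ c ∧ a ≠ d ∧ b ≠ c ∧ b ≠ d ∧ c ≠ d := by
  have key : ∀ x y z : α, ({x, y, z} : Finset α).card ≤ 3 := fun x y z => Finset.card_le_three
  refine ⟨?_, ?_, ?_, ?_, ?_, ?_⟩ <;> rintro rfl
  · have := key a c d; simp at h; omega
  · have := key b a d
    have e : ({a, b, a, d} : Finset α) = {b, a, d} := by ext; simp <;> tauto
    rw [e] at h; omega
  · have := key b c a
    have e : ({a, b, c, a} : Finset α) = {b, c, a} := by ext; simp <;> tauto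
    rw [e] at h; omega
  · have := key a b d
    have e : ({a, b, b, d} : Finset α) = {a, b, d} := by ext; simp
    rw [e] at h; omega
  · have := key a c b
    have e : ({a, b, c, b} : Finset α) = {a, c, b} := by ext; simp <;> tauto
    rw [e] at h; omega
  · have := key a b c
    have e : ({a, b, c, c} : Finset α) = {a, b, c} := by ext; simp
    rw [e] at h; omega

lemma next_distinct (hn : IsRotorSequence next) {A : Vtx} (hA : A ∈ DIRset) :
    A ≠ next A ∧ A ≠ next^[2] A ∧ A ≠ next^[3] A ∧ next A ≠ next^[2] A ∧
      next A ≠ next^[3] A ∧ next^[2] A ≠ next^[3] A :=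
  four_distinct (by rw [hn A hA]; exact DIR_card :
    ({A, next A, next^[2] A, next^[3] A} : Finset Vtx).card = 4)

lemma next_four (hn : IsRotorSequence next) {A : Vtx} (hA : A ∈ DIRset) : next^[4] A = A := by
  have h1 := next_distinct hn hA
  have h2 := hn (next A) (next_mem hn hA)
  rw [← h2] at hA
  simp only [Finset.mem_insert, Finset.mem_singleton, ← Function.iterate_succ_apply] at hA
  obtain ⟨a, b, c, _⟩ := h1
  rcases hA with h | h | h | h
  · exact absurd h a
  · exact absurd h b
  · exact absurd h c
  · exact h.symm

lemma iter_add_four (hn : IsRotorSequence next) {A : Vtx} (hA : A ∈ DIRset) (i : ℕ) :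
    next^[i + 4] A = next^[i] A := by
  rw [Function.iterate_add_apply, next_four hn hA]

lemma iter_add_four_mul (hn : IsRotorSequence next) {A : Vtx} (hA : A ∈ DIRset) (i m : ℕ) :
    next^[i + 4 * m] A = next^[i] A := by
  induction m with
  | zero => rfl
  | succ m ih => rw [show i + 4 * (m+1) = (i + 4 * m) + 4 by ring, iter_add_four hn hA, ih]

lemma iter_mod (hn : IsRotorSequence next) {A : Vtx} (hA : A ∈ DIRset) {i j : ℕ}
    (h : i % 4 = j % 4) : next^[i] A = next^[j] A := by
  rw [← Nat.mod_add_div i 4, ← Nat.mod_add_div j 4, iter_add_four_mul hn hA,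
    iter_add_four_mul hn hA, h]

lemma sum_four (hn : IsRotorSequence next) {M : Type*} [AddCommMonoid M] (g : Vtx → M)
    {A : Vtx} (hA : A ∈ DIRset) (i : ℕ) :
    g (next^[i] A) + g (next^[i+1] A) + g (next^[i+2] A) + g (next^[i+3] A)
      = ∑ B ∈ DIRset, g B := by
  have hB := iter_mem hn hA i
  have e : ∀ j, next^[i + j] A = next^[j] (next^[i] A) := fun j => by
    rw [add_comm, Function.iterate_add_apply]
  simp only [e]
  generalize next^[i] A = B at hB
  obtain ⟨h1, h2, h3, h4, h5, h6⟩ := next_distinct hn hB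
  simp only [Function.iterate_one]
  rw [← hn B hB, Finset.sum_insert, Finset.sum_insert, Finset.sum_insert, Finset.sum_singleton]
  · simp only [add_assoc]
  · simpa using h6
  · simp only [Finset.mem_insert, Finset.mem_singleton]; tauto
  · simp only [Finset.mem_insert, Finset.mem_singleton]; tauto

/-- count of the chips sent in direction `A` -/
lemma count_add (hn : IsRotorSequence next) {d A : Vtx} (hd : d ∈ DIRset) (hA : A ∈ DIRset)
    (k m : ℕ) :
    ((Finset.range (k + 4 * m)).filter (fun i => next^[i] d = A)).card =
      ((Finset.range k).filter (fun i => next^[i] d = A)).card + m := by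
  induction m with
  | zero => rfl
  | succ m ih =>
    simp only [Finset.card_filter] at *
    rw [show k + 4 * (m+1) = (k + 4 * m) + 1 + 1 + 1 + 1 by ring, Finset.sum_range_succ,
      Finset.sum_range_succ, Finset.sum_range_succ, Finset.sum_range_succ, ih]
    have := sum_four hn (fun B => if B = A then 1 else 0) hd (k + 4 * m)
    simp only [Finset.sum_ite_eq', hA, if_true] at this
    simp only [add_assoc, Nat.reduceAdd] at this ⊢
    omega

lemma exists_sym (hn : IsRotorSequence next) : ∃ e : ℤ, (e = 1 ∨ e = -1) ∧
    ∀ A ∈ DIRset, next (-(next A).1, e * (next A).2) = (-A.1, e * A.2) := by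
  have ha := hn (1,1) (by decide)
  have hb := hn (1,-1) (by decide)
  have hc := hn (-1,-1) (by decide)
  have hd := hn (-1,1) (by decide)
  have ma := mem_DIR.1 (next_mem hn (A := (1,1)) (by decide))
  have mb := mem_DIR.1 (next_mem hn (A := (1,-1)) (by decide))
  have mc := mem_DIR.1 (next_mem hn (A := (-1,-1)) (by decide))
  have md := mem_DIR.1 (next_mem hn (A := (-1,1)) (by decide))
  simp only [Function.iterate_succ_apply, Function.iterate_zero_apply] at ha hb hc hd
  simp only [mem_DIR]
  rcases ma with ma | ma | ma | ma <;> rcases mb with mb | mb | mb | mb <;>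
  rcases mc with mc | mc | mc | mc <;> rcases md with md | md | md | md <;>
  simp only [ma, mb, mc, md] at ha hb hc hd <;>
  first
  | (exfalso; revert ha; decide)
  | (exfalso; revert hb; decide)
  | (refine ⟨1, Or.inl rfl, ?_⟩; rintro A (rfl | rfl | rfl | rfl) <;> simp [ma, mb, mc, md]; done)
  | (refine ⟨-1, Or.inr rfl, ?_⟩; rintro A (rfl | rfl | rfl | rfl) <;> simp [ma, mb, mc, md]; done)

end RotorFacts

section HFacts

/-- one dimensional factor -/
noncomputable def hh (a : ℤ) (t : ℕ) : ℝ :=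
  if a % 2 = (t : ℤ) % 2 ∧ |a| ≤ (t : ℤ) then
    (Nat.choose t (((t : ℤ) + a) / 2).toNat : ℝ) / 2 ^ t else 0

lemma H_eq (x : Vtx) (t : ℕ) : H x t = hh x.1 t * hh x.2 t := by
  unfold H hh
  have : (4:ℝ) ^ (-(t:ℤ)) = 1 / 2 ^ t * (1 / 2 ^ t) := by
    rw [zpow_neg, zpow_natCast, show (4:ℝ) = 2 * 2 by norm_num, mul_pow]; field_simp
  rw [this]
  split_ifs with h1 h2 h3 h3 <;> first | (exfalso; tauto) | skip
  · ring
  all_goals simp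

lemma hh_nonneg (a : ℤ) (t : ℕ) : 0 ≤ hh a t := by
  unfold hh; split_ifs <;> positivity

lemma hh_neg (a : ℤ) (t : ℕ) : hh (-a) t = hh a t := by
  unfold hh
  by_cases h : a % 2 = (t : ℤ) % 2 ∧ |a| ≤ (t : ℤ)
  · rw [if_pos h, if_pos (by rw [abs_neg]; omega)]
    obtain ⟨h1, h2⟩ := h
    rw [abs_le] at h2
    congr 2
    apply Nat.choose_symm_of_eq_add
    omega
  · rw [if_neg h, if_neg (by rw [abs_neg]; omega)]

/-- ratio identity -/
lemma hh_ratio (a : ℤ) (t : ℕ) :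
    ((t:ℝ) + 1) * hh (a + 1) t = ((t:ℝ) + 1 - a) * hh a (t+1) := by
  by_cases hp : a % 2 = ((t+1 : ℕ) : ℤ) % 2
  swap
  · unfold hh
    rw [if_neg (by omega), if_neg (by omega)]; simp
  by_cases ha : |a| ≤ ((t+1 : ℕ) : ℤ)
  swap
  · unfold hh
    have : ¬ |a+1| ≤ (t:ℤ) := by rw [abs_le] at *; push_cast at *; omega
    rw [if_neg (by tauto), if_neg (by tauto)]; simp
  rw [abs_le] at ha
  by_cases ht : a = t + 1
  · have : ¬ |a+1| ≤ (t:ℤ) := by rw [abs_le]; omega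
    unfold hh
    rw [if_neg (by tauto), ht]; push_cast; ring
  · have h1 : (a+1) % 2 = (t:ℤ) % 2 ∧ |a+1| ≤ (t:ℤ) := by
      rw [abs_le]; push_cast at *; omega
    have h2 : a % 2 = ((t+1 : ℕ) : ℤ) % 2 ∧ |a| ≤ ((t+1 : ℕ) : ℤ) := ⟨hp, by rwa [abs_le]⟩
    unfold hh
    rw [if_pos h1, if_pos h2]
    obtain ⟨k, hk⟩ : ∃ k : ℕ, (t:ℤ) + 1 + a = 2 * k :=
      ⟨(((t:ℤ) + 1 + a) / 2).toNat, by push_cast at *; omega⟩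
    have e1 : (((t:ℤ) + (a+1)) / 2).toNat = k := by omega
    have e2 : ((((t + 1 : ℕ):ℤ) + a) / 2).toNat = k := by push_cast; omega
    rw [e1, e2]
    have hkt : k ≤ t := by omega
    have key := Nat.choose_mul_succ_eq t k
    have hk' : (a:ℝ) = 2 * k - (t + 1) := by
      have : (a:ℝ) = ((a:ℤ):ℝ) := rfl
      have h3 : a = 2 * k - (t + 1) := by omega
      rw [h3]; push_cast; ring
    have key' : ((t.choose k : ℕ):ℝ) * (t + 1) = ((t+1).choose k : ℕ) * ((t:ℝ) + 1 - k) := by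
      have := congrArg (fun n : ℕ => (n:ℝ)) key
      push_cast [Nat.cast_sub (by omega : k ≤ t + 1)] at this
      exact this
    rw [hk', pow_succ]
    field_simp
    linear_combination 2 * key'

lemma hh_ratio' (a : ℤ) (t : ℕ) :
    ((t:ℝ) + 1) * hh (a - 1) t = ((t:ℝ) + 1 + a) * hh a (t+1) := by
  have := hh_ratio (-a) t
  rw [show -a + 1 = -(a - 1) by ring, hh_neg, hh_neg] at this
  push_cast at this
  linear_combination this

lemma hh_rec (a : ℤ) (t : ℕ) : hh a (t+1) = (hh (a+1) t + hh (a-1) t) / 2 := by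
  have h1 := hh_ratio a t
  have h2 := hh_ratio' a t
  have : (0:ℝ) < (t:ℝ) + 1 := by positivity
  apply mul_left_cancel₀ this.ne'
  linear_combination (-h1 - h2) / 2

lemma cb_bound (n : ℕ) : (2 * n + 1) * n.centralBinom ^ 2 ≤ 16 ^ n := by
  induction n with
  | zero => simp
  | succ n ih =>
    have h := Nat.succ_mul_centralBinom_succ n
    have hp : 0 < (n+1)^2 := by positivity
    refine Nat.le_of_mul_le_mul_left ?_ hp
    calc (n+1)^2 * ((2 * (n+1) + 1) * (n+1).centralBinom ^ 2)
        = (2 * (n+1) + 1) * ((n+1) * (n+1).centralBinom) ^ 2 := by ring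
      _ = (4 * ((2 * n + 1) * (2 * n + 3))) * ((2 * n + 1) * n.centralBinom ^ 2) := by
          rw [h]; ring
      _ ≤ (16 * (n+1)^2) * 16 ^ n := by
          apply Nat.mul_le_mul _ ih
          nlinarith
      _ = (n+1)^2 * 16 ^ (n+1) := by ring

lemma hh_even_bound (a : ℤ) (n : ℕ) : hh a (2 * n) ≤ (n.centralBinom : ℝ) / 4 ^ n := by
  unfold hh
  split_ifs with h
  · rw [pow_mul]; norm_num
    gcongr
    exact Nat.choose_le_centralBinom _ _
  · positivity

lemma hh_bound (a : ℤ) (t : ℕ) : hh a t ^ 2 * t ≤ 1 := by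
  have hb : ∀ n : ℕ, ((n.centralBinom : ℝ) / 4 ^ n)^2 * (2 * n + 1) ≤ 1 := fun n => by
    have := cb_bound n
    have h' : ((2 * n + 1) * n.centralBinom ^ 2 : ℝ) ≤ 16 ^ n := by exact_mod_cast this
    rw [div_pow, ← pow_mul, mul_comm n 2, pow_mul, div_mul_eq_mul_div, div_le_one (by positivity)]
    norm_num
    linarith
  obtain ⟨n, rfl | rfl⟩ := Nat.even_or_odd' t
  · have h1 := hh_even_bound a n
    have h0 := hh_nonneg a (2 * n)
    calc hh a (2*n) ^ 2 * ((2 * n : ℕ):ℝ) ≤ ((n.centralBinom : ℝ) / 4 ^ n)^2 * (2 * n + 1) := by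
          push_cast; gcongr; linarith
      _ ≤ 1 := hb n
  · have h1 : hh a (2 * n + 1) ≤ (n.centralBinom : ℝ) / 4 ^ n := by
      rw [hh_rec]
      have := hh_even_bound (a+1) n
      have := hh_even_bound (a-1) n
      linarith
    have h0 := hh_nonneg a (2 * n + 1)
    calc hh a (2*n+1) ^ 2 * ((2 * n + 1 : ℕ):ℝ)
        ≤ ((n.centralBinom : ℝ) / 4 ^ n)^2 * (2 * n + 1) := by
          push_cast; gcongr
      _ ≤ 1 := hb n

lemma H_bound (x : Vtx) (t : ℕ) : H x t * t ≤ 1 := by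
  rw [H_eq]
  have h1 := hh_bound x.1 t
  have h2 := hh_bound x.2 t
  have : (0:ℝ) ≤ t := by positivity
  nlinarith [mul_nonneg this (sq_nonneg (hh x.1 t - hh x.2 t))]

lemma H_nonneg (x : Vtx) (t : ℕ) : 0 ≤ H x t := by
  rw [H_eq]; exact mul_nonneg (hh_nonneg _ _) (hh_nonneg _ _)

lemma hh_ratio_sgn (a s : ℤ) (hs : s = 1 ∨ s = -1) (t : ℕ) :
    ((t:ℝ) + 1) * hh (a + s) t = ((t:ℝ) + 1 - s * a) * hh a (t+1) := by
  rcases hs with rfl | rfl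
  · rw [hh_ratio]; push_cast; ring
  · rw [← sub_eq_add_neg, hh_ratio']; push_cast; ring

lemma DIR_sgn {A : Vtx} (hA : A ∈ DIRset) : (A.1 = 1 ∨ A.1 = -1) ∧ (A.2 = 1 ∨ A.2 = -1) := by
  rcases mem_DIR.1 hA with rfl | rfl | rfl | rfl <;> simp

lemma INF_bound (x A : Vtx) (hA : A ∈ DIRset) (t : ℕ) :
    |INF x A (t+1)| ≤ (|(x.1:ℝ)| + |(x.2:ℝ)| + |(x.1:ℝ)| * |(x.2:ℝ)|) * (1 / ((t:ℝ)+1)^2) := by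
  obtain ⟨hs1, hs2⟩ := DIR_sgn hA
  have h1 := hh_ratio_sgn x.1 A.1 hs1 t
  have h2 := hh_ratio_sgn x.2 A.2 hs2 t
  have e1 : |(A.1:ℝ)| = 1 := by rcases hs1 with h | h <;> simp [h]
  have e2 : |(A.2:ℝ)| = 1 := by rcases hs2 with h | h <;> simp [h]
  have hb := H_bound x (t+1)
  have h0 := H_nonneg x (t+1)
  have hT : (0:ℝ) < (t:ℝ) + 1 := by positivity
  have hT1 : (1:ℝ) ≤ (t:ℝ) + 1 := by linarith [(Nat.cast_nonneg t : (0:ℝ) ≤ t)]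
  push_cast at hb
  have key : ((t:ℝ)+1)^2 * INF x A (t+1) = H x (t+1) *
      (-(A.1 * x.1 + A.2 * x.2) * ((t:ℝ)+1) + (A.1 * x.1) * (A.2 * x.2)) := by
    unfold INF
    rw [Nat.add_sub_cancel, H_eq, H_eq, Prod.fst_add, Prod.snd_add]
    have := congrArg₂ (· * ·) h1 h2
    linear_combination this
  rw [mul_one_div, le_div_iff₀ (by positivity), mul_comm]
  calc ((t:ℝ)+1)^2 * |INF x A (t+1)| = |((t:ℝ)+1)^2 * INF x A (t+1)| := by
        rw [abs_mul, abs_of_nonneg (by positivity : (0:ℝ) ≤ ((t:ℝ)+1)^2)]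
    _ = H x (t+1) * |(-(A.1 * x.1 + A.2 * x.2) * ((t:ℝ)+1) + (A.1 * x.1) * (A.2 * x.2))| := by
        rw [key, abs_mul, abs_of_nonneg h0]
    _ ≤ H x (t+1) * ((|(x.1:ℝ)| + |(x.2:ℝ)| + |(x.1:ℝ)| * |(x.2:ℝ)|) * ((t:ℝ)+1)) := by
        gcongr
        have a1 : |(A.1 * x.1 : ℝ)| = |(x.1:ℝ)| := by rw [abs_mul, e1, one_mul]
        have a2 : |(A.2 * x.2 : ℝ)| = |(x.2:ℝ)| := by rw [abs_mul, e2, one_mul]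
        calc _ ≤ |(-(A.1 * x.1 + A.2 * x.2) * ((t:ℝ)+1))| + |((A.1 * x.1) * (A.2 * x.2) : ℝ)| :=
              abs_add_le _ _
          _ = |(A.1 * x.1 + A.2 * x.2 : ℝ)| * ((t:ℝ)+1) + |(x.1:ℝ)| * |(x.2:ℝ)| := by
              rw [abs_mul, abs_neg, abs_of_pos hT, abs_mul (A.1 * x.1 : ℝ), a1, a2]
          _ ≤ (|(x.1:ℝ)| + |(x.2:ℝ)|) * ((t:ℝ)+1) + |(x.1:ℝ)| * |(x.2:ℝ)| * ((t:ℝ)+1) := by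
              refine add_le_add (mul_le_mul_of_nonneg_right ?_ hT.le) ?_
              · rw [← a1, ← a2]; exact abs_add_le _ _
              · exact le_mul_of_one_le_right (by positivity) hT1
          _ = _ := by ring
    _ = (|(x.1:ℝ)| + |(x.2:ℝ)| + |(x.1:ℝ)| * |(x.2:ℝ)|) * (H x (t+1) * ((t:ℝ)+1)) := by ring
    _ ≤ _ := mul_le_of_le_one_right (by positivity) hb

lemma INF_sum_zero (x : Vtx) (t : ℕ) : ∑ A ∈ DIRset, INF x A (t+1) = 0 := by
  have : ∀ g : Vtx → ℝ, ∑ A ∈ DIRset, g A = g (1,1) + (g (1,-1) + (g (-1,-1) + g (-1,1))) := by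
    intro g
    unfold DIRset
    rw [Finset.sum_insert (by decide), Finset.sum_insert (by decide),
      Finset.sum_insert (by decide), Finset.sum_singleton]
  rw [this]
  simp only [INF, Nat.add_sub_cancel, H_eq, Prod.fst_add, Prod.snd_add, hh_rec, ← sub_eq_add_neg]
  ring

lemma H_rec (x : Vtx) (t : ℕ) : H x (t+1) = 1/4 * ∑ A ∈ DIRset, H (x + A) t := by
  have := INF_sum_zero x t
  simp only [INF, Nat.add_sub_cancel, Finset.sum_sub_distrib, Finset.sum_const, DIR_card] at this
  simp at this
  linarith

lemma H_neg_iff (x : Vtx) (s : ℤ) (hs : s = 1 ∨ s = -1) (t : ℕ) :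
    H (-x.1, s * x.2) t = H x t := by
  rcases hs with rfl | rfl <;> simp [H_eq, hh_neg]

lemma H_zero (x : Vtx) : H x 0 = if x = (0,0) then 1 else 0 := by
  unfold H
  by_cases h : x = (0,0)
  · subst h; simp
  · rw [if_neg h, if_neg]
    rintro ⟨_, _, h1, h2⟩
    apply h
    simp at h1 h2
    exact Prod.ext h1 h2

end HFacts

section Con

/-- partial sums -/
def NN (k : ℕ → ℕ) (t : ℕ) : ℕ := ∑ s ∈ Finset.range t, k s

lemma NN_succ (k : ℕ → ℕ) (t : ℕ) : NN k (t+1) = NN k t + k t := Finset.sum_range_succ _ _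

lemma NN_mono (k : ℕ → ℕ) : Monotone (NN k) :=
  monotone_nat_of_le_succ fun t => by rw [NN_succ]; omega

noncomputable def Gs (next : Vtx → Vtx) (x r : Vtx) (u n : ℕ) : ℝ :=
  ∑ j ∈ Finset.range n, INF x (next^[j] r) u

noncomputable def conk (next : Vtx → Vtx) (x r : Vtx) (k : ℕ → ℕ) (T : ℕ) : ℝ :=
  ∑ t ∈ Finset.range T, (Gs next x r (T - t) (NN k (t+1)) - Gs next x r (T - t) (NN k t))

lemma sum_stime (k : ℕ → ℕ) (F : ℕ → ℕ → ℝ) (T : ℕ) :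
    ∑ i ∈ Finset.range (NN k T), F i (sInf {u : ℕ | i < NN k (u + 1)}) =
      ∑ t ∈ Finset.range T, ∑ i ∈ Finset.Ico (NN k t) (NN k (t+1)), F i t := by
  induction T with
  | zero => simp [NN]
  | succ T ih =>
    rw [Finset.sum_range_succ, ← ih]
    rw [← Finset.sum_range_add_sum_Ico _ (NN_mono k (Nat.le_succ T))]
    congr 1
    apply Finset.sum_congr rfl
    intro i hi
    rw [Finset.mem_Ico] at hi
    have : IsLeast {u : ℕ | i < NN k (u + 1)} T := by
      refine ⟨hi.2, fun u hu => ?_⟩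
      by_contra hlt
      push Not at hlt
      have := NN_mono k (show u + 1 ≤ T from hlt)
      have hu' : i < NN k (u+1) := hu
      omega
    rw [this.csInf_eq]

lemma con_eq (next : Vtx → Vtx) (f0 : Vtx → ℕ) (arr0 : Vtx → Vtx) (x : Vtx) (T : ℕ) :
    con next f0 arr0 x T
      = conk next x (arr0 x) (fun t => (propp next f0 arr0 t).1 x) T := by
  have := sum_stime (fun t => (propp next f0 arr0 t).1 x)
    (fun i s => INF x (next^[i] (arr0 x)) (T - s)) T
  unfold con conk sTime
  refine Eq.trans this ?_
  apply Finset.sum_congr rfl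
  intro t _
  rw [Finset.sum_Ico_eq_sub _ (NN_mono _ (Nat.le_succ t))]
  rfl

lemma rotor_eq (next : Vtx → Vtx) (f0 : Vtx → ℕ) (arr0 : Vtx → Vtx) (x : Vtx) (t : ℕ) :
    (propp next f0 arr0 t).2 x = next^[NN (fun t => (propp next f0 arr0 t).1 x) t] (arr0 x) := by
  induction t with
  | zero => rfl
  | succ t ih =>
    rw [NN_succ, add_comm (NN _ _), Function.iterate_add_apply, ← ih]
    rfl

lemma Gs_period {next : Vtx → Vtx} (hn : IsRotorSequence next) (x : Vtx) {r : Vtx}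
    (hr : r ∈ DIRset) (u n : ℕ) : Gs next x r (u+1) (n + 4) = Gs next x r (u+1) n := by
  unfold Gs
  rw [show n + 4 = n + 1 + 1 + 1 + 1 by ring, Finset.sum_range_succ, Finset.sum_range_succ,
    Finset.sum_range_succ, Finset.sum_range_succ]
  have := sum_four hn (fun A => INF x A (u+1)) hr n
  rw [INF_sum_zero] at this
  simp only [add_assoc, Nat.reduceAdd] at this ⊢
  linarith

lemma Gs_mod {next : Vtx → Vtx} (hn : IsRotorSequence next) (x : Vtx) {r : Vtx}
    (hr : r ∈ DIRset) (u n : ℕ) : Gs next x r (u+1) n = Gs next x r (u+1) (n % 4) := by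
  have : ∀ m i, Gs next x r (u+1) (i + 4 * m) = Gs next x r (u+1) i := by
    intro m i
    induction m with
    | zero => rfl
    | succ m ih => rw [show i + 4 * (m+1) = i + 4 * m + 4 by ring, Gs_period hn x hr, ih]
  conv_lhs => rw [← Nat.mod_add_div n 4, this]

lemma NN_mod {k k' : ℕ → ℕ} {T : ℕ} (h : ∀ t < T, k t % 4 = k' t % 4) :
    ∀ t ≤ T, NN k t % 4 = NN k' t % 4 := by
  intro t
  induction t with
  | zero => intro _; rfl
  | succ t ih =>
    intro ht
    have h1 := ih (by omega)
    have h2 := h t (by omega)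
    rw [NN_succ, NN_succ]
    omega

lemma conk_congr {next : Vtx → Vtx} (hn : IsRotorSequence next) (x : Vtx) {r : Vtx}
    (hr : r ∈ DIRset) {k k' : ℕ → ℕ} {T : ℕ} (h : ∀ t < T, k t % 4 = k' t % 4) :
    conk next x r k T = conk next x r k' T := by
  unfold conk
  apply Finset.sum_congr rfl
  intro t ht
  rw [Finset.mem_range] at ht
  obtain ⟨u, hu⟩ : ∃ u, T - t = u + 1 := ⟨T - t - 1, by omega⟩
  rw [hu, Gs_mod hn x hr, Gs_mod hn x hr u (NN k t), NN_mod h _ (by omega), NN_mod h _ ht.le,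
    ← Gs_mod hn x hr, ← Gs_mod hn x hr]

lemma conk_zero (next : Vtx → Vtx) (x r : Vtx) (T : ℕ) : conk next x r (fun _ => 0) T = 0 := by
  unfold conk
  apply Finset.sum_eq_zero
  intro t _
  simp [NN]

lemma conk_bdd {next : Vtx → Vtx} (hn : IsRotorSequence next) (x : Vtx) :
    ∃ B : ℝ, ∀ r ∈ DIRset, ∀ k T, conk next x r k T ≤ B := by
  set C : ℝ := |(x.1:ℝ)| + |(x.2:ℝ)| + |(x.1:ℝ)| * |(x.2:ℝ)| with hC
  have hC0 : 0 ≤ C := by positivity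
  have hsum : Summable (fun t : ℕ => 8 * C * (1 / ((t:ℝ)+1)^2)) := by
    apply Summable.mul_left
    have := (summable_nat_add_iff 1).2 (Real.summable_one_div_nat_pow.2 (by norm_num : 1 < 2))
    simpa using this
  refine ⟨∑' t : ℕ, 8 * C * (1 / ((t:ℝ)+1)^2), ?_⟩
  intro r hr k T
  have hG : ∀ u n, |Gs next x r (u+1) n| ≤ 4 * C * (1 / ((u:ℝ)+1)^2) := by
    intro u n
    rw [Gs_mod hn x hr]
    unfold Gs
    calc _ ≤ ∑ j ∈ Finset.range (n % 4), |INF x (next^[j] r) (u+1)| :=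
          Finset.abs_sum_le_sum_abs _ _
      _ ≤ ∑ j ∈ Finset.range (n % 4), C * (1 / ((u:ℝ)+1)^2) :=
          Finset.sum_le_sum fun j _ => INF_bound x _ (iter_mem hn hr j) u
      _ = ((n % 4 : ℕ):ℝ) * (C * (1 / ((u:ℝ)+1)^2)) := by simp
      _ ≤ 4 * (C * (1 / ((u:ℝ)+1)^2)) := by
          gcongr
          exact_mod_cast (Nat.mod_lt n (by norm_num)).le
      _ = _ := by ring
  calc conk next x r k T ≤ ∑ t ∈ Finset.range T, 8 * C * (1 / (((T - 1 - t : ℕ):ℝ)+1)^2) := by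
        unfold conk
        apply Finset.sum_le_sum
        intro t ht
        rw [Finset.mem_range] at ht
        have e : T - t = (T - 1 - t) + 1 := by omega
        rw [e]
        have h1 := abs_le.1 (hG (T - 1 - t) (NN k (t+1)))
        have h2 := abs_le.1 (hG (T - 1 - t) (NN k t))
        linarith [h1.2, h2.1]
    _ = ∑ t ∈ Finset.range T, 8 * C * (1 / ((t:ℝ)+1)^2) :=
        Finset.sum_range_reflect (fun t : ℕ => 8 * C * (1 / ((t:ℝ)+1)^2)) T
    _ ≤ _ := hsum.sum_le_tsum _ (fun t _ => by positivity)

/-- parity support of a chip pattern at `x` -/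
def Supp (x : Vtx) (k : ℕ → ℕ) : Prop :=
  ∀ t : ℕ, ¬ (x.1 % 2 = (t:ℤ) % 2 ∧ x.2 % 2 = (t:ℤ) % 2) → k t = 0

lemma hh_parity {a : ℤ} {t : ℕ} (h : a % 2 ≠ (t:ℤ) % 2) : hh a t = 0 := by
  unfold hh; rw [if_neg (by tauto)]

lemma conk_odd {next : Vtx → Vtx} (hn : IsRotorSequence next) (x : Vtx) {r : Vtx}
    (hr : r ∈ DIRset) {k : ℕ → ℕ} (hk : Supp x k) {T : ℕ} (hT : T % 2 = 1) :
    conk next x r k T = 0 := by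
  unfold conk
  apply Finset.sum_eq_zero
  intro t ht
  rw [Finset.mem_range] at ht
  by_cases hp : x.1 % 2 = (t:ℤ) % 2 ∧ x.2 % 2 = (t:ℤ) % 2
  swap
  · rw [NN_succ, hk t hp]; simp
  have : ∀ n, Gs next x r (T - t) n = 0 := by
    intro n
    unfold Gs
    apply Finset.sum_eq_zero
    intro j _
    have hs := (DIR_sgn (iter_mem hn hr j)).1
    unfold INF
    rw [H_eq, H_eq, hh_parity, hh_parity (a := x.1)]
    · simp
    · omega
    · rw [Prod.fst_add]; omega
  simp [this]

lemma conk_shift (next : Vtx → Vtx) (x r : Vtx) (k : ℕ → ℕ) (T d : ℕ) :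
    conk next x r (fun t => if t < d then 0 else k (t - d)) (d + T) = conk next x r k T := by
  set k' : ℕ → ℕ := fun t => if t < d then 0 else k (t - d) with hk'
  have h1 : ∀ t ≤ d, NN k' t = 0 := by
    intro t ht
    apply Finset.sum_eq_zero
    intro s hs
    rw [Finset.mem_range] at hs
    simp only [hk']; rw [if_pos (by omega)]
  have h2 : ∀ t, NN k' (d + t) = NN k t := by
    intro t
    induction t with
    | zero => rw [add_zero, h1 d le_rfl]; rfl
    | succ t ih => rw [← add_assoc, NN_succ, NN_succ, ih]; simp [hk']
  unfold conk
  rw [Finset.sum_range_add]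
  rw [Finset.sum_eq_zero, zero_add]
  · apply Finset.sum_congr rfl
    intro t _
    rw [add_assoc, h2, h2, Nat.add_sub_add_left]
  · intro t ht
    rw [Finset.mem_range] at ht
    rw [h1 _ ht, h1 _ ht.le]; simp

lemma Gs_add (next : Vtx → Vtx) (x r : Vtx) (u m n : ℕ) :
    Gs next x r u (m + n) - Gs next x r u m
      = ∑ j ∈ Finset.range n, INF x (next^[j] (next^[m] r)) u := by
  unfold Gs
  rw [Finset.sum_range_add, add_sub_cancel_left]
  apply Finset.sum_congr rfl
  intro j _
  rw [add_comm, Function.iterate_add_apply]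

/-- the complementary pattern on the reflected vertex -/
lemma conk_neg {next : Vtx → Vtx} (hn : IsRotorSequence next) {e : ℤ} (he : e = 1 ∨ e = -1)
    (hσ : ∀ A ∈ DIRset, next (-(next A).1, e * (next A).2) = (-A.1, e * A.2))
    (x : Vtx) {r : Vtx} (hr : r ∈ DIRset) (k : ℕ → ℕ) (T : ℕ) :
    conk next (-x.1, e * x.2) (-(next^[3] r).1, e * (next^[3] r).2) (fun t => 3 * k t) T
      = - conk next x r k T := by
  have hN : ∀ t, NN (fun t => 3 * k t) t = 3 * NN k t := fun t => by
    unfold NN; rw [Finset.mul_sum]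
  have hinf : ∀ A u, INF (-x.1, e * x.2) (-A.1, e * A.2) u = INF x A u := by
    intro A u
    unfold INF
    rw [H_neg_iff x e he]
    congr 1
    have := H_neg_iff (x + A) e he (u-1)
    rw [← this]
    congr 1
    ext <;> simp <;> ring
  have hit : ∀ i, ∀ A ∈ DIRset, next^[i] (-A.1, e * A.2)
      = (-(next^[3 * i] A).1, e * (next^[3 * i] A).2) := by
    intro i A hA
    induction i with
    | zero => rfl
    | succ i ih =>
      rw [Function.iterate_succ_apply', ih]
      have h3 := hσ (next^[3 * (i+1)] A) (iter_mem hn hA _)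
      rw [← Function.iterate_succ_apply' next, show (3 * (i+1)).succ = 3 * i + 4 by omega,
        iter_add_four hn hA] at h3
      exact h3
  unfold conk
  rw [← Finset.sum_neg_distrib]
  apply Finset.sum_congr rfl
  intro t ht
  rw [Finset.mem_range] at ht
  obtain ⟨u, hu⟩ : ∃ u, T - t = u + 1 := ⟨T - t - 1, by omega⟩
  rw [hu, hN, hN, NN_succ, mul_add, Gs_add, Gs_add]
  generalize NN k t = K
  generalize k t = m
  have hd := iter_mem hn hr K
  have hrot : ∀ j, next^[j] (next^[3 * K] (-(next^[3] r).1, e * (next^[3] r).2))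
      = (-(next^[3 * j + 3] (next^[K] r)).1, e * (next^[3 * j + 3] (next^[K] r)).2) := by
    intro j
    rw [← Function.iterate_add_apply, hit _ _ (iter_mem hn hr 3), ← Function.iterate_add_apply,
      ← Function.iterate_add_apply, iter_mod hn hr
      (show (3 * (j + 3 * K) + 3) % 4 = (3 * j + 3 + K) % 4 by omega)]
  simp only [hrot, hinf]
  generalize next^[K] r = d at hd
  induction m with
  | zero => simp
  | succ m ih =>
    rw [show 3 * (m + 1) = 3 * m + 1 + 1 + 1 by ring, Finset.sum_range_succ,
      Finset.sum_range_succ, Finset.sum_range_succ, ih, Finset.sum_range_succ]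
    have := sum_four hn (fun A => INF x A (u+1)) hd m
    rw [INF_sum_zero] at this
    rw [iter_mod hn hd (show (3 * (3 * m) + 3) % 4 = (m + 3) % 4 by omega),
      iter_mod hn hd (show (3 * (3 * m + 1) + 3) % 4 = (m + 2) % 4 by omega),
      iter_mod hn hd (show (3 * (3 * m + 1 + 1) + 3) % 4 = (m + 1) % 4 by omega)]
    linarith

end Con

section Forcing

lemma sum_DIR {M : Type*} [AddCommMonoid M] (g : Vtx → M) :
    ∑ A ∈ DIRset, g A = g (1,1) + (g (1,-1) + (g (-1,-1) + g (-1,1))) := by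
  unfold DIRset
  rw [Finset.sum_insert (by decide), Finset.sum_insert (by decide),
    Finset.sum_insert (by decide), Finset.sum_singleton]

/-- `x ~ t` -/
def Par (x : Vtx) (t : ℕ) : Prop := x.1 % 2 = (t:ℤ) % 2 ∧ x.2 % 2 = (t:ℤ) % 2

lemma Par_sub {y A : Vtx} {t : ℕ} (hA : A ∈ DIRset) : Par (y - A) t ↔ Par y (t+1) := by
  obtain ⟨h1, h2⟩ := DIR_sgn hA
  unfold Par
  rw [Prod.fst_sub, Prod.snd_sub]
  push_cast
  omega

lemma propp_succ_fst (next : Vtx → Vtx) (f0 : Vtx → ℕ) (arr0 : Vtx → Vtx) (t : ℕ) (y : Vtx) :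
    (propp next f0 arr0 (t+1)).1 y = ∑ A ∈ DIRset,
      ((Finset.range ((propp next f0 arr0 t).1 (y - A))).filter
        (fun i => next^[i] ((propp next f0 arr0 t).2 (y - A)) = A)).card := rfl

lemma propp_succ_snd (next : Vtx → Vtx) (f0 : Vtx → ℕ) (arr0 : Vtx → Vtx) (t : ℕ) (x : Vtx) :
    (propp next f0 arr0 (t+1)).2 x
      = next^[(propp next f0 arr0 t).1 x] ((propp next f0 arr0 t).2 x) := rfl

lemma propp_par (next : Vtx → Vtx) {f0 : Vtx → ℕ} (hf : EvenConfig f0) (arr0 : Vtx → Vtx)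
    (t : ℕ) (x : Vtx) (hx : ¬ Par x t) : (propp next f0 arr0 t).1 x = 0 := by
  induction t generalizing x with
  | zero => exact hf x (by simpa [Par] using hx)
  | succ t ih =>
    rw [propp_succ_fst]
    apply Finset.sum_eq_zero
    intro A hA
    rw [ih (x - A) (by rwa [Par_sub hA])]
    simp

/-- The neighbour sum operator. -/
def LL {R : Type*} [AddCommMonoid R] (g : Vtx → R) : Vtx → R :=
  fun y => ∑ A ∈ DIRset, g (y - A)

lemma solve1 {R : Type*} [AddCommGroup R] (p : ℤ → R) :
    ∃ g : ℤ → R, ∀ a, g (a - 1) + g (a + 1) = p a := by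
  -- pairs (g n, g (n+1)) going up, and (g (-n), g (1-n)) going down
  obtain ⟨up, hu0, hup⟩ : ∃ up : ℕ → R × R, up 0 = (0, 0) ∧
      ∀ n : ℕ, up (n+1) = ((up n).2, p (n + 1) - (up n).1) :=
    ⟨fun n => Nat.rec (0, 0) (fun n q => (q.2, p (n + 1) - q.1)) n, rfl, fun _ => rfl⟩
  obtain ⟨dn, hd0, hdn⟩ : ∃ dn : ℕ → R × R, dn 0 = (0, 0) ∧
      ∀ n : ℕ, dn (n+1) = (p (-n) - (dn n).2, (dn n).1) :=
    ⟨fun n => Nat.rec (0, 0) (fun n q => (p (-n) - q.2, q.1)) n, rfl, fun _ => rfl⟩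
  refine ⟨fun a => if 0 ≤ a then (up a.toNat).1 else (dn (-a).toNat).1, ?_⟩
  intro a
  rcases lt_trichotomy a 0 with h | h | h
  · obtain ⟨n, rfl⟩ : ∃ n : ℕ, a = -((n:ℤ) + 1) := ⟨(-a - 1).toNat, by omega⟩
    have e1 : (-(-((n:ℤ)+1) - 1)).toNat = n + 1 + 1 := by omega
    simp only
    rw [if_neg (by omega), e1, hdn, hdn]
    push_cast
    rcases Nat.eq_zero_or_pos n with rfl | hn
    · simp [hu0, hd0]
    · rw [if_neg (by omega), show (-(-((n:ℤ)+1) + 1)).toNat = n by omega]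
      simp
  · subst h
    have e : up 1 = (0, p 1) := by have := hup 0; simpa [hu0] using this
    have e' : dn 1 = (p 0, 0) := by have := hdn 0; simpa [hd0] using this
    simp [e, e']
  · obtain ⟨n, rfl⟩ : ∃ n : ℕ, a = (n:ℤ) + 1 := ⟨(a - 1).toNat, by omega⟩
    simp only
    rw [if_pos (by omega), if_pos (by omega), show ((n:ℤ) + 1 - 1).toNat = n by omega,
      show ((n:ℤ) + 1 + 1).toNat = n + 1 + 1 by omega, hup, hup]
    simp

lemma LL_surj {R : Type*} [AddCommGroup R] (p : Vtx → R) : ∃ g : Vtx → R, LL g = p := by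
  choose g1 hg1 using fun b : ℤ => solve1 (fun a => p (a, b))
  choose g2 hg2 using fun a : ℤ => solve1 (fun b => g1 b a)
  refine ⟨fun x => g2 x.1 x.2, ?_⟩
  funext ⟨a, b⟩
  have h1 := hg1 b a
  have h2 := hg2 (a-1) b
  have h3 := hg2 (a+1) b
  unfold LL
  rw [sum_DIR, ← h1, ← h2, ← h3]
  simp only [Prod.mk_sub_mk, sub_neg_eq_add]
  abel

lemma LL_iter_surj {R : Type*} [AddCommGroup R] (n : ℕ) (p : Vtx → R) :
    ∃ g : Vtx → R, LL^[n] g = p := by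
  induction n generalizing p with
  | zero => exact ⟨p, rfl⟩
  | succ n ih =>
    obtain ⟨q, hq⟩ := LL_surj p
    obtain ⟨g, hg⟩ := ih q
    exact ⟨g, by rw [Function.iterate_succ_apply', hg, hq]⟩

lemma LL_iter_congr {R : Type*} [AddCommMonoid R] (g g' : Vtx → R)
    (h : ∀ x, Par x 0 → g x = g' x) (n : ℕ) : ∀ x, Par x n → LL^[n] g x = LL^[n] g' x := by
  induction n with
  | zero => exact h
  | succ n ih =>
    intro x hx
    rw [Function.iterate_succ_apply', Function.iterate_succ_apply']
    exact Finset.sum_congr rfl fun A hA => ih _ ((Par_sub hA).2 hx)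

lemma LL_iter_cast (g : Vtx → ℕ) (n : ℕ) (x : Vtx) :
    ((LL^[n] g x : ℕ) : ZMod 4) = LL^[n] (fun y => (g y : ZMod 4)) x := by
  induction n generalizing x with
  | zero => rfl
  | succ n ih =>
    rw [Function.iterate_succ_apply', Function.iterate_succ_apply']
    simp only [LL]
    rw [Nat.cast_sum]
    exact Finset.sum_congr rfl fun A _ => ih _

open Classical in
lemma exists_g (n : ℕ) (p : Vtx → ZMod 4) : ∃ g : Vtx → ℕ, EvenConfig g ∧
    ∀ x, Par x n → ((LL^[n] g x : ℕ) : ZMod 4) = p x := by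
  obtain ⟨g, hg⟩ := LL_iter_surj n p
  refine ⟨fun x => if Par x 0 then (g x).val else 0, ?_, ?_⟩
  · intro x hx
    exact if_neg (by simpa [Par] using hx)
  · intro x hx
    rw [LL_iter_cast, ← hg]
    apply LL_iter_congr _ _ _ n x hx
    intro y hy
    simp [hy]

lemma propp_add {next : Vtx → Vtx} (hn : IsRotorSequence next) (f0 g : Vtx → ℕ)
    {arr0 : Vtx → Vtx} (harr : ∀ y, arr0 y ∈ DIRset) (n : ℕ) :
    ∀ t ≤ n, (∀ x, (propp next (fun x => f0 x + 4 ^ n * g x) arr0 t).1 x =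
        (propp next f0 arr0 t).1 x + 4 ^ (n - t) * LL^[t] g x) ∧
      (∀ x, (propp next (fun x => f0 x + 4 ^ n * g x) arr0 t).2 x = (propp next f0 arr0 t).2 x) := by
  intro t
  induction t with
  | zero => intro _; exact ⟨fun x => rfl, fun x => rfl⟩
  | succ t ih =>
    intro ht
    obtain ⟨h1, h2⟩ := ih (by omega)
    have e : 4 ^ (n - t) = 4 * 4 ^ (n - (t+1)) := by
      rw [← pow_succ']; congr 1; omega
    have hrot : ∀ x, (propp next f0 arr0 t).2 x ∈ DIRset := fun x => by
      rw [rotor_eq]; exact iter_mem hn (harr x) _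
    constructor
    · intro x
      rw [propp_succ_fst, propp_succ_fst, Function.iterate_succ_apply']
      simp only [LL]
      rw [Finset.mul_sum, ← Finset.sum_add_distrib]
      apply Finset.sum_congr rfl
      intro A hA
      rw [h1, h2, e, mul_assoc, count_add hn (hrot _) hA]
    · intro x
      rw [propp_succ_snd, propp_succ_snd, h1, h2, e, mul_assoc, iter_add_four_mul hn (hrot _)]

lemma forcing {next : Vtx → Vtx} (hn : IsRotorSequence next)
    {arr0 : Vtx → Vtx} (harr : ∀ y, arr0 y ∈ DIRset) (π : Vtx → ℕ → ℕ) (T : ℕ) :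
    ∃ f0, EvenConfig f0 ∧ ∀ t < T, ∀ x, Par x t →
      (propp next f0 arr0 t).1 x % 4 = π x t % 4 := by
  induction T with
  | zero => exact ⟨fun _ => 0, fun _ _ => rfl, fun t ht => absurd ht (by omega)⟩
  | succ T ih =>
    obtain ⟨f0, hf, h⟩ := ih
    obtain ⟨g, hg, hgp⟩ := exists_g T
      (fun x => (π x T : ZMod 4) - ((propp next f0 arr0 T).1 x : ZMod 4))
    refine ⟨fun x => f0 x + 4 ^ T * g x, ?_, ?_⟩
    · intro x hx
      simp [hf x hx, hg x hx]
    · intro t ht x hx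
      rw [(propp_add hn f0 g harr T t (by omega)).1 x]
      rcases Nat.lt_succ_iff_lt_or_eq.1 ht with h' | rfl
      · obtain ⟨m, hm⟩ : ∃ m, T - t = m + 1 := ⟨T - t - 1, by omega⟩
        rw [hm, pow_succ', mul_assoc, Nat.add_mul_mod_self_left]
        exact h t h' x hx
      · have h3 := hgp x hx
        rw [Nat.sub_self, pow_zero, one_mul]
        change _ ≡ _ [MOD 4]
        rw [← ZMod.natCast_eq_natCast_iff, Nat.cast_add, h3]
        ring

/-- patterns can be realised simultaneously -/
lemma realise {next : Vtx → Vtx} (hn : IsRotorSequence next)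
    {arr0 : Vtx → Vtx} (harr : ∀ y, arr0 y ∈ DIRset) (π : Vtx → ℕ → ℕ)
    (hπ : ∀ x, Supp x (π x)) (T : ℕ) :
    ∃ f0, EvenConfig f0 ∧ ∀ x, con next f0 arr0 x T = conk next x (arr0 x) (π x) T := by
  obtain ⟨f0, hf, h⟩ := forcing hn harr π T
  refine ⟨f0, hf, fun x => ?_⟩
  rw [con_eq]
  apply conk_congr hn x (harr x)
  intro t ht
  by_cases hx : Par x t
  · exact h t ht x hx
  · rw [propp_par next hf arr0 t x hx, hπ x t hx]

end Forcing

section Identity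

lemma H_out {x : Vtx} {u T : ℕ} (hu : u ≤ T)
    (hx : x ∉ (Finset.Icc (-(T:ℤ)) T) ×ˢ (Finset.Icc (-(T:ℤ)) T)) : H x u = 0 := by
  unfold H
  rw [if_neg]
  rintro ⟨_, _, h1, h2⟩
  apply hx
  rw [abs_le] at h1 h2
  rw [Finset.mem_product, Finset.mem_Icc, Finset.mem_Icc]
  omega

lemma H_out' {x A : Vtx} (hA : A ∈ DIRset) {u T : ℕ} (hu : u + 1 ≤ T)
    (hx : x ∉ (Finset.Icc (-(T:ℤ)) T) ×ˢ (Finset.Icc (-(T:ℤ)) T)) : H (x + A) u = 0 := by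
  obtain ⟨s1, s2⟩ := DIR_sgn hA
  unfold H
  rw [if_neg]
  rintro ⟨_, _, h1, h2⟩
  apply hx
  rw [abs_le, Prod.fst_add] at h1
  rw [abs_le, Prod.snd_add] at h2
  rw [Finset.mem_product, Finset.mem_Icc, Finset.mem_Icc]
  omega

lemma summable_H (g : Vtx → ℝ) (u : ℕ) : Summable (fun x => g x * H x u) :=
  summable_of_ne_finset_zero (s := (Finset.Icc (-(u:ℤ)) u) ×ˢ (Finset.Icc (-(u:ℤ)) u))
    fun x hx => by rw [H_out le_rfl hx, mul_zero]

lemma summable_H' (g : Vtx → ℝ) {A : Vtx} (hA : A ∈ DIRset) (u : ℕ) :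
    Summable (fun x => g x * H (x + A) u) :=
  summable_of_ne_finset_zero
    (s := (Finset.Icc (-((u+1:ℕ):ℤ)) (u+1:ℕ)) ×ˢ (Finset.Icc (-((u+1:ℕ):ℤ)) (u+1:ℕ)))
    fun x hx => by rw [H_out' hA le_rfl hx, mul_zero]

lemma shift_sum (g : Vtx → Vtx → ℝ) (u : ℕ) :
    ∑' y, (∑ A ∈ DIRset, g A (y - A)) * H y u = ∑' x, ∑ A ∈ DIRset, g A x * H (x + A) u := by
  rw [Summable.tsum_finsetSum (fun A hA => summable_H' (g A) hA u)]
  simp only [Finset.sum_mul]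
  rw [Summable.tsum_finsetSum (fun A _ => summable_H (fun y => g A (y - A)) u)]
  apply Finset.sum_congr rfl
  intro A _
  rw [← (Equiv.addRight A).tsum_eq]
  simp

lemma lin_const (f0 : Vtx → ℕ) (T : ℕ) : ∀ t ≤ T,
    ∑' x, lin f0 t x * H x (T - t) = ∑' x, (f0 x : ℝ) * H x T := by
  intro t
  induction t with
  | zero => intro _; rfl
  | succ t ih =>
    intro ht
    rw [← ih (by omega)]
    obtain ⟨u, hu⟩ : ∃ u, T - t = u + 1 := ⟨T - t - 1, by omega⟩
    have hu' : T - (t+1) = u := by omega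
    rw [hu, hu']
    have h1 : ∀ x, lin f0 (t+1) x = ∑ A ∈ DIRset, (fun _ y => 1/4 * lin f0 t y) A (x - A) := by
      intro x
      show (1/4) * ∑ A ∈ DIRset, lin f0 t (x + A) = _
      rw [Finset.mul_sum, sum_DIR, sum_DIR]
      simp only [sub_eq_add_neg, Prod.neg_mk, neg_neg]
      ring
    simp only [h1]
    refine (shift_sum (fun _ y => 1/4 * lin f0 t y) u).trans ?_
    apply tsum_congr
    intro x
    rw [H_rec, ← Finset.mul_sum]
    ring

lemma lin_eq (f0 : Vtx → ℕ) (T : ℕ) : lin f0 T (0,0) = ∑' x, (f0 x : ℝ) * H x T := by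
  rw [← lin_const f0 T T le_rfl, Nat.sub_self, tsum_eq_single (0,0)]
  · simp [H_zero]
  · intro x hx; rw [H_zero, if_neg hx, mul_zero]

lemma INF_out {x A : Vtx} (hA : A ∈ DIRset) {u T : ℕ} (hu : u + 1 ≤ T)
    (hx : x ∉ (Finset.Icc (-(T:ℤ)) T) ×ˢ (Finset.Icc (-(T:ℤ)) T)) : INF x A (u+1) = 0 := by
  unfold INF
  rw [Nat.add_sub_cancel, H_out' hA hu hx, H_out hu hx, sub_zero]

variable {next : Vtx → Vtx}

lemma Gs_out (hn : IsRotorSequence next) {x r : Vtx} (hr : r ∈ DIRset) {u T : ℕ} (hu : u + 1 ≤ T)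
    (hx : x ∉ (Finset.Icc (-(T:ℤ)) T) ×ˢ (Finset.Icc (-(T:ℤ)) T)) (n : ℕ) :
    Gs next x r (u+1) n = 0 :=
  Finset.sum_eq_zero fun j _ => INF_out (iter_mem hn hr j) hu hx

lemma conk_out (hn : IsRotorSequence next) {x r : Vtx} (hr : r ∈ DIRset) {T : ℕ} (k : ℕ → ℕ)
    (hx : x ∉ (Finset.Icc (-(T:ℤ)) T) ×ˢ (Finset.Icc (-(T:ℤ)) T)) :
    conk next x r k T = 0 := by
  apply Finset.sum_eq_zero
  intro t ht
  rw [Finset.mem_range] at ht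
  obtain ⟨u, hu⟩ : ∃ u, T - t = u + 1 := ⟨T - t - 1, by omega⟩
  rw [hu, Gs_out hn hr (by omega) hx, Gs_out hn hr (by omega) hx, sub_zero]

lemma con_summable (hn : IsRotorSequence next) (f0 : Vtx → ℕ) {arr0 : Vtx → Vtx}
    (harr : ∀ y, arr0 y ∈ DIRset) (T : ℕ) : Summable (fun x => con next f0 arr0 x T) :=
  summable_of_ne_finset_zero (s := (Finset.Icc (-(T:ℤ)) T) ×ˢ (Finset.Icc (-(T:ℤ)) T))
    fun x hx => by rw [con_eq, conk_out hn (harr x) _ hx]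

lemma step_eq (hn : IsRotorSequence next) (f0 : Vtx → ℕ) {arr0 : Vtx → Vtx}
    (harr : ∀ y, arr0 y ∈ DIRset) (t u : ℕ) :
    ∑' x, ((propp next f0 arr0 (t+1)).1 x : ℝ) * H x u
      - ∑' x, ((propp next f0 arr0 t).1 x : ℝ) * H x (u+1)
    = ∑' x, (Gs next x (arr0 x) (u+1) (NN (fun t => (propp next f0 arr0 t).1 x) (t+1))
      - Gs next x (arr0 x) (u+1) (NN (fun t => (propp next f0 arr0 t).1 x) t)) := by
  set c : Vtx → Vtx → ℝ := fun A x =>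
    (((Finset.range ((propp next f0 arr0 t).1 x)).filter
        (fun i => next^[i] ((propp next f0 arr0 t).2 x) = A)).card : ℝ) with hc
  have h1 : ∀ y, ((propp next f0 arr0 (t+1)).1 y : ℝ) = ∑ A ∈ DIRset, c A (y - A) := by
    intro y; rw [propp_succ_fst, Nat.cast_sum]
  simp only [h1]
  rw [shift_sum, ← Summable.tsum_sub (summable_sum fun A hA => summable_H' (c A) hA u)
    (summable_H _ _)]
  apply tsum_congr
  intro x
  have hrot : (propp next f0 arr0 t).2 x ∈ DIRset := by
    rw [rotor_eq]; exact iter_mem hn (harr x) _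
  rw [NN_succ, Gs_add, ← rotor_eq]
  simp only [hc, Finset.card_filter, Nat.cast_sum, Finset.sum_mul]
  rw [Finset.sum_comm]
  unfold INF
  rw [Finset.sum_sub_distrib]
  congr 1
  · apply Finset.sum_congr rfl
    intro i _
    rw [Finset.sum_eq_single (next^[i] ((propp next f0 arr0 t).2 x))]
    · simp
    · intro B _ hB
      rw [if_neg (Ne.symm hB)]; simp
    · intro h; exact absurd (iter_mem hn hrot i) h
  · simp

lemma discr_eq (hn : IsRotorSequence next) (f0 : Vtx → ℕ) {arr0 : Vtx → Vtx}
    (harr : ∀ y, arr0 y ∈ DIRset) (T : ℕ) :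
    ((propp next f0 arr0 T).1 (0,0) : ℝ) - lin f0 T (0,0) = ∑' x, con next f0 arr0 x T := by
  have h1 : ((propp next f0 arr0 T).1 (0,0) : ℝ)
      = ∑' x, ((propp next f0 arr0 T).1 x : ℝ) * H x (T - T) := by
    rw [Nat.sub_self, tsum_eq_single (0,0)]
    · simp [H_zero]
    · intro x hx; rw [H_zero, if_neg hx, mul_zero]
  have h2 : lin f0 T (0,0) = ∑' x, ((propp next f0 arr0 0).1 x : ℝ) * H x (T - 0) := lin_eq f0 T
  rw [h1, h2, ← Finset.sum_range_sub
    (fun t => ∑' x, ((propp next f0 arr0 t).1 x : ℝ) * H x (T - t))]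
  simp only [con_eq, conk]
  rw [Summable.tsum_finsetSum]
  · apply Finset.sum_congr rfl
    intro t ht
    rw [Finset.mem_range] at ht
    obtain ⟨u, hu⟩ : ∃ u, T - t = u + 1 := ⟨T - t - 1, by omega⟩
    have hu' : T - (t+1) = u := by omega
    rw [hu, hu']
    exact step_eq hn f0 harr t u
  · intro t ht
    rw [Finset.mem_range] at ht
    obtain ⟨u, hu⟩ : ∃ u, T - t = u + 1 := ⟨T - t - 1, by omega⟩
    rw [hu]
    refine summable_of_ne_finset_zero (s := (Finset.Icc (-(T:ℤ)) T) ×ˢ (Finset.Icc (-(T:ℤ)) T))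
      fun x hx => ?_
    rw [Gs_out hn (harr x) (by omega) hx, Gs_out hn (harr x) (by omega) hx, sub_zero]

end Identity

section Final

variable {next : Vtx → Vtx}

lemma con_bddAbove (hn : IsRotorSequence next) (x : Vtx) :
    BddAbove {c : ℝ | ∃ f0 arr0 T, EvenConfig f0 ∧ (∀ y : Vtx, arr0 y ∈ DIRset) ∧
      c = con next f0 arr0 x T} := by
  obtain ⟨B, hB⟩ := conk_bdd hn x
  refine ⟨B, ?_⟩
  rintro c ⟨f0, arr0, T, _, harr, rfl⟩
  rw [con_eq]; exact hB _ (harr x) _ _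

lemma con_le (hn : IsRotorSequence next) {f0 : Vtx → ℕ} {arr0 : Vtx → Vtx} (hf : EvenConfig f0)
    (harr : ∀ y : Vtx, arr0 y ∈ DIRset) (x : Vtx) (T : ℕ) :
    con next f0 arr0 x T ≤ maxcon next x :=
  le_csSup (con_bddAbove hn x) ⟨f0, arr0, T, hf, harr, rfl⟩

open Classical in
lemma conk_le (hn : IsRotorSequence next) (x : Vtx) {r : Vtx} (hr : r ∈ DIRset) {k : ℕ → ℕ}
    (hk : Supp x k) (T : ℕ) : conk next x r k T ≤ maxcon next x := by
  obtain ⟨f0, hf, h⟩ := realise hn (arr0 := fun _ => r) (fun _ => hr)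
    (fun y => if y = x then k else fun _ => 0)
    (fun y => by
      by_cases h : y = x
      · subst h; simpa using hk
      · simp only [h, if_false]; intro t _; rfl) T
  have := h x
  simp only [if_true] at this
  rw [← this]
  exact con_le hn hf (fun _ => hr) x T

lemma Supp_zero (x : Vtx) : Supp x (fun _ => 0) := fun _ _ => rfl

lemma maxcon_nonneg (hn : IsRotorSequence next) (x : Vtx) : 0 ≤ maxcon next x := by
  have := conk_le hn x (r := (1,1)) (by decide) (Supp_zero x) 0
  rwa [conk_zero] at this

lemma exists_near (hn : IsRotorSequence next) (x : Vtx) {ε : ℝ} (hε : 0 < ε) :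
    ∃ r ∈ DIRset, ∃ k T, Supp x k ∧ T % 2 = 0 ∧ maxcon next x - ε ≤ conk next x r k T := by
  have hne : ({c : ℝ | ∃ f0 arr0 T, EvenConfig f0 ∧ (∀ y : Vtx, arr0 y ∈ DIRset) ∧
      c = con next f0 arr0 x T}).Nonempty :=
    ⟨_, fun _ => 0, fun _ => (1,1), 0, fun _ _ => rfl, fun _ => mem_DIR.2 (Or.inl rfl), rfl⟩
  obtain ⟨c, ⟨f0, arr0, T, hf, harr, rfl⟩, hc⟩ :=
    exists_lt_of_lt_csSup hne (show maxcon next x - ε < _ from sub_lt_self _ hε)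
  rw [con_eq] at hc
  have hS : Supp x (fun t => (propp next f0 arr0 t).1 x) :=
    fun t ht => propp_par next hf arr0 t x ht
  rcases Nat.mod_two_eq_zero_or_one T with h | h
  · exact ⟨arr0 x, harr x, _, T, hS, h, hc.le⟩
  · rw [conk_odd hn x (harr x) hS h] at hc
    exact ⟨arr0 x, harr x, fun _ => 0, 0, Supp_zero x, rfl, by rw [conk_zero]; exact hc.le⟩

open Classical in
lemma lower (hn : IsRotorSequence next) (F : Finset Vtx) {ε : ℝ} (hε : 0 < ε) :
    ∃ f0 arr0 T, EvenConfig f0 ∧ (∀ y : Vtx, arr0 y ∈ DIRset) ∧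
      ∑ x ∈ F, (maxcon next x - ε) ≤
        ((propp next f0 arr0 T).1 (0, 0) : ℝ) - lin f0 T (0, 0) := by
  choose r hr k Tx hk hT hle using fun x => exists_near hn x hε
  set T := ∑ x ∈ F, Tx x with hTdef
  have hTle : ∀ x ∈ F, Tx x ≤ T := fun x hx =>
    Finset.single_le_sum (f := Tx) (fun _ _ => Nat.zero_le _) hx
  have hT2 : T % 2 = 0 := Nat.mod_eq_zero_of_dvd
    (Finset.dvd_sum fun x _ => Nat.dvd_of_mod_eq_zero (hT x))
  obtain ⟨f0, hf, h⟩ := realise hn hr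
    (fun x => if x ∈ F then (fun t => if t < T - Tx x then 0 else k x (t - (T - Tx x)))
      else fun _ => 0)
    (fun x => by
      by_cases hx : x ∈ F
      · simp only [hx, if_true]
        intro t ht
        simp only
        split_ifs with h1
        · rfl
        · apply hk x
          have := hTle x hx
          have := hT x
          omega
      · simp only [hx, if_false]; exact Supp_zero x) T
  refine ⟨f0, r, T, hf, hr, ?_⟩
  rw [discr_eq hn f0 hr, tsum_eq_sum (s := F)]
  · apply Finset.sum_le_sum
    intro x hx
    rw [h x, if_pos hx]
    have e : T = (T - Tx x) + Tx x := by have := hTle x hx; omega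
    have := conk_shift next x (r x) (k x) (Tx x) (T - Tx x)
    rw [← e] at this
    rw [this]
    exact hle x
  · intro x hx
    rw [h x, if_neg hx, conk_zero]

lemma maxcon_out (hn : IsRotorSequence next) {x : Vtx} (hx : ¬ inV x) : maxcon next x = 0 := by
  apply le_antisymm _ (maxcon_nonneg hn x)
  apply csSup_le
  · exact ⟨_, fun _ => 0, fun _ => (1,1), 0, fun _ _ => rfl, fun _ => mem_DIR.2 (Or.inl rfl), rfl⟩
  · rintro c ⟨f0, arr0, T, hf, harr, rfl⟩
    have : ∀ t, (propp next f0 arr0 t).1 x = 0 := fun t =>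
      propp_par next hf arr0 t x (by unfold inV at hx; unfold Par; omega)
    rw [con_eq]
    simp only [this]
    rw [conk_zero]

/-- the symmetry as an equivalence -/
def symE (e : ℤ) (he : e = 1 ∨ e = -1) : Vtx ≃ Vtx where
  toFun x := (-x.1, e * x.2)
  invFun x := (-x.1, e * x.2)
  left_inv x := by rcases he with rfl | rfl <;> simp
  right_inv x := by rcases he with rfl | rfl <;> simp

lemma upper (hn : IsRotorSequence next) (hs : Summable (maxcon next)) {f0 : Vtx → ℕ}
    {arr0 : Vtx → Vtx} (hf : EvenConfig f0) (harr : ∀ y : Vtx, arr0 y ∈ DIRset) (T : ℕ) :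
    |((propp next f0 arr0 T).1 (0, 0) : ℝ) - lin f0 T (0, 0)| ≤ ∑' x, maxcon next x := by
  rw [discr_eq hn f0 harr, abs_le']
  have hc := con_summable hn f0 harr T
  constructor
  · exact hc.tsum_le_tsum (fun x => con_le hn hf harr x T) hs
  · obtain ⟨e, he, hσ⟩ := exists_sym hn
    rw [← tsum_neg, ← (symE e he).tsum_eq (maxcon next)]
    refine Summable.tsum_le_tsum (fun x => ?_) hc.neg ((symE e he).summable_iff.2 hs)
    rw [con_eq, ← conk_neg hn he hσ x (harr x)]
    apply conk_le hn (symE e he x)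
    · have h3 := iter_mem hn (harr x) 3
      rcases mem_DIR.1 h3 with h | h | h | h <;> rw [h] <;> rcases he with rfl | rfl <;> decide
    · intro t ht
      have : (propp next f0 arr0 t).1 x = 0 := by
        apply propp_par next hf
        intro hp
        apply ht
        unfold Par at hp
        rcases he with rfl | rfl <;> simp only [symE, Equiv.coe_fn_mk] <;> omega
      simp [this]

end Final

/-- The supremum, over all even initial configurations and all run-times, of
the single-vertex discrepancy `|f(0,T) − E(0,T)|` equals the sum of the
maximal contributions of all vertices of `V`. -/
theorem sup_discrepancy_eq_sum_maxcon (next : Vtx → Vtx)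
    (hnext : IsRotorSequence next) :
    sSup {d : ℝ | ∃ (f0 : Vtx → ℕ) (arr0 : Vtx → Vtx) (T : ℕ),
        EvenConfig f0 ∧ (∀ y : Vtx, arr0 y ∈ DIRset) ∧
        d = |((propp next f0 arr0 T).1 (0, 0) : ℝ) - lin f0 T (0, 0)|}
      = ∑' x : {x : Vtx // inV x}, maxcon next x.1 := by
  have htsum : ∑' x : {x : Vtx // inV x}, maxcon next x.1 = ∑' x, maxcon next x :=
    tsum_subtype_eq_of_support_subset (s := {x | inV x}) (f := maxcon next) (by
      intro x hx
      by_contra h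
      exact hx (maxcon_out hnext h))
  rw [htsum]
  set D : Set ℝ := {d : ℝ | ∃ (f0 : Vtx → ℕ) (arr0 : Vtx → Vtx) (T : ℕ),
        EvenConfig f0 ∧ (∀ y : Vtx, arr0 y ∈ DIRset) ∧
        d = |((propp next f0 arr0 T).1 (0, 0) : ℝ) - lin f0 T (0, 0)|} with hD
  have hne : D.Nonempty :=
    ⟨_, fun _ => 0, fun _ => (1,1), 0, fun _ _ => rfl, fun _ => mem_DIR.2 (Or.inl rfl), rfl⟩
  by_cases hb : BddAbove D
  · have hF : ∀ F : Finset Vtx, ∑ x ∈ F, maxcon next x ≤ sSup D := by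
      intro F
      apply le_of_forall_pos_le_add
      intro ε hε
      obtain ⟨f0, arr0, T, hf, harr, h⟩ :=
        lower hnext F (show 0 < ε / (F.card + 1) by positivity)
      have h1 : |((propp next f0 arr0 T).1 (0, 0) : ℝ) - lin f0 T (0, 0)| ≤ sSup D :=
        le_csSup hb ⟨f0, arr0, T, hf, harr, rfl⟩
      have h2 := le_abs_self (((propp next f0 arr0 T).1 (0, 0) : ℝ) - lin f0 T (0, 0))
      rw [Finset.sum_sub_distrib, Finset.sum_const, nsmul_eq_mul] at h
      have h3 : (F.card : ℝ) * (ε / (F.card + 1)) ≤ ε := by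
        rw [mul_div_assoc', div_le_iff₀ (by positivity)]
        nlinarith
      linarith
    have hs : Summable (maxcon next) :=
      summable_of_sum_le (fun x => maxcon_nonneg hnext x) hF
    apply le_antisymm
    · apply csSup_le hne
      rintro d ⟨f0, arr0, T, hf, harr, rfl⟩
      exact upper hnext hs hf harr T
    · exact hs.tsum_le_of_sum_le hF
  · rw [Real.sSup_of_not_bddAbove hb, tsum_eq_zero_of_not_summable]
    intro hs
    apply hb
    refine ⟨∑' x, maxcon next x, ?_⟩
    rintro d ⟨f0, arr0, T, hf, harr, rfl⟩
    exact upper hnext hs hf harr T
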